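/- Let 𝓕 = (F_1,F_2) be a pair of finite sets of positive integers, not both empty. Then: (i) the map α ↦ Ω_𝓕^α(0) is a polynomial in α of degree u_𝓕 + k_1 which does not vanish at any real α ∉ {−1,−2,−3,…}; (ii) for every real α with ∏_{i=1}^{min(k_1,k_2)}(α+i)_{k_1+k_2−2i+1} ≠ 0, one has Ω_𝓕^α(0) = (−1)^{C(k_1,2)} · [∏_{j=1}^{2} V_{F_j}·∏_{i=1}^{k_j}(α+i)_{k_j−i+1}·∏_{f∈F_j}(α+k_j+1)_{f−k_j}] / [∏_{f∈F_1} f!·∏_{f∈F_2} f!·∏_{i=1}^{min(k_1,k_2)}(α+i)_{k_1+k_2−2i+1}] · ∏_{f∈F_1}∏_{g∈F_2}(α+f+g+1), where V_F = ∏_{1≤i<j≤m}(f_j−f_i) for F = {f_1 < ⋯ < f_m} and (t)_m = t(t+1)⋯(t+m−1) is the Pochhammer symbol. -/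

import Mathlib

open Finset MeasureTheory Polynomial

/-- Generalized binomial coefficient `C(t, j) = t(t-1)⋯(t-j+1)/j!`. -/
noncomputable def gbinom (t : ℝ) (j : ℕ) : ℝ :=
  (∏ i ∈ Finset.range j, (t - i)) / (Nat.factorial j)

/-- Pochhammer symbol `(t)_m = t(t+1)⋯(t+m-1)`. -/
noncomputable def poch (t : ℝ) (m : ℕ) : ℝ := ∏ i ∈ Finset.range m, (t + i)

/-- Pochhammer symbol with integer index (Γ-quotient convention for negative index). -/
noncomputable def pochZ (t : ℝ) (m : ℤ) : ℝ :=
  if 0 ≤ m then ∏ i ∈ Finset.range m.toNat, (t + i)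
  else (∏ i ∈ Finset.range (-m).toNat, (t - (i + 1)))⁻¹

/-- `ĉ = max(-⌊c⌋, 0)`. -/
noncomputable def chat (c : ℝ) : ℕ := (-⌊c⌋).toNat

/-- Admissibility of `c` and the pair `𝓕 = (F₁, F₂)`. -/
def IsAdmissible (c : ℝ) (F1 F2 : Finset ℕ) : Prop :=
  ∀ x : ℕ, 0 ≤ (∏ f ∈ F1, ((x : ℝ) - f)) * (∏ f ∈ F2, ((x : ℝ) + c + f)) /
    poch ((x : ℝ) + c) (chat c)

/-- `u_𝓕 = ∑_{f∈F₁} f + ∑_{f∈F₂} f - C(k₁+1, 2) - C(k₂, 2)`. -/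
def uF (F1 F2 : Finset ℕ) : ℕ :=
  (∑ f ∈ F1, f + ∑ f ∈ F2, f) - (Nat.choose (F1.card + 1) 2 + Nat.choose F2.card 2)

/-- `σ_𝓕 = {u_𝓕, u_𝓕+1, …} \ {u_𝓕 + f : f ∈ F₁}`. -/
def sigmaF (F1 F2 : Finset ℕ) : Set ℕ :=
  {n | uF F1 F2 ≤ n ∧ ∀ f ∈ F1, n ≠ uF F1 F2 + f}

/-- The `i`-th element (0-based) of `F` in increasing order. -/
def nth (F : Finset ℕ) (i : ℕ) : ℕ := (F.sort (· ≤ ·)).getD i 0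
/-- The Laguerre polynomial `L_n^α` as a real polynomial. -/
noncomputable def lag (α : ℝ) (n : ℕ) : Polynomial ℝ :=
  ∑ j ∈ Finset.range (n + 1),
    Polynomial.C ((-1 : ℝ) ^ j / (Nat.factorial j : ℝ) * gbinom ((n : ℝ) + α) (n - j)) *
      Polynomial.X ^ j

/-- `j`-th derivative of a real polynomial. -/
noncomputable def iterDeriv (j : ℕ) (p : Polynomial ℝ) : Polynomial ℝ :=
  (fun q => Polynomial.derivative q)^[j] p

/-- The polynomial `L_n^{α;𝓕}` (Wronskian type determinant of Laguerre polynomials). -/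
noncomputable def lagExc (α : ℝ) (F1 F2 : Finset ℕ) (n : ℕ) : Polynomial ℝ :=
  Matrix.det (Matrix.of fun i j : Fin (F1.card + F2.card + 1) =>
    if (i : ℕ) = 0 then iterDeriv (j : ℕ) (lag α (n - uF F1 F2))
    else if (i : ℕ) - 1 < F1.card then iterDeriv (j : ℕ) (lag α (nth F1 ((i : ℕ) - 1)))
    else (lag (α + ((j : ℕ) : ℝ)) (nth F2 ((i : ℕ) - 1 - F1.card))).comp (-Polynomial.X))

/-- The Wronskian type determinant `Ω_𝓕^α` as a real polynomial. -/
noncomputable def OmegaL (α : ℝ) (F1 F2 : Finset ℕ) : Polynomial ℝ :=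
  Matrix.det (Matrix.of fun i j : Fin (F1.card + F2.card) =>
    if (i : ℕ) < F1.card then iterDeriv (j : ℕ) (lag α (nth F1 (i : ℕ)))
    else (lag (α + ((j : ℕ) : ℝ)) (nth F2 ((i : ℕ) - F1.card))).comp (-Polynomial.X))
/-- The Vandermonde determinant `V_F = ∏_{i<j} (f_j - f_i)` of a finite set of naturals. -/
noncomputable def VF (F : Finset ℕ) : ℝ :=
  ∏ p ∈ F.offDiag.filter (fun p => p.1 < p.2), ((p.2 : ℝ) - (p.1 : ℝ))

lemma poch_eq_eval (t : ℝ) (m : ℕ) : poch t m = (ascPochhammer ℝ m).eval t := by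
  induction m with
  | zero => simp [poch]
  | succ n ih => rw [ascPochhammer_succ_eval, ← ih, poch, poch, Finset.prod_range_succ]

lemma poch_add (t : ℝ) (m n : ℕ) : poch t (m + n) = poch t m * poch (t + m) n := by
  unfold poch
  rw [Finset.prod_range_add]
  congr 1
  refine Finset.prod_congr rfl fun i _ => ?_
  push_cast; ring

lemma poch_neg (f j : ℕ) : poch (-(f : ℝ)) j = (-1) ^ j * (f.descFactorial j : ℝ) := by
  induction j with
  | zero => simp [poch]
  | succ j ih =>
    have : poch (-(f : ℝ)) (j + 1) = poch (-(f : ℝ)) j * (-(f : ℝ) + j) := by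
      rw [poch, poch, Finset.prod_range_succ]
    rw [this, ih, Nat.descFactorial_succ]
    rcases le_or_gt j f with h | h
    · push_cast [Nat.cast_sub h]; ring
    · simp [Nat.descFactorial_of_lt h]

lemma gbinom_eq (α : ℝ) (n j : ℕ) (h : j ≤ n) :
    gbinom ((n : ℝ) + α) (n - j) = poch (α + j + 1) (n - j) / ((n - j).factorial : ℝ) := by
  unfold gbinom poch
  congr 1
  rw [← Finset.prod_range_reflect]
  refine Finset.prod_congr rfl fun i hi => ?_
  have hi := Finset.mem_range.1 hi
  have : n - j - 1 - i + (1 + i + j) = n := by omega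
  have h2 : ((n - j - 1 - i : ℕ) : ℝ) = n - (1 + i + j) := by
    rw [eq_sub_iff_add_eq]; exact_mod_cast this
  rw [h2]; ring

lemma coeff_lag (α : ℝ) (n j : ℕ) : (lag α n).coeff j =
    if j ≤ n then (-1 : ℝ) ^ j / (Nat.factorial j : ℝ) * gbinom ((n : ℝ) + α) (n - j) else 0 := by
  unfold lag
  simp only [Polynomial.finsetSum_coeff, Polynomial.coeff_C_mul, Polynomial.coeff_X_pow]
  simp only [mul_ite, mul_one, mul_zero, Finset.sum_ite_eq, Finset.mem_range, Nat.lt_succ_iff]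

lemma eval_iterDeriv (α : ℝ) (n j : ℕ) : (iterDeriv j (lag α n)).eval 0 =
    if j ≤ n then (-1 : ℝ) ^ j * gbinom ((n : ℝ) + α) (n - j) else 0 := by
  have : iterDeriv j (lag α n) = (⇑Polynomial.derivative)^[j] (lag α n) := rfl
  rw [this, ← Polynomial.coeff_zero_eq_eval_zero, Polynomial.coeff_iterate_derivative, coeff_lag]
  simp only [zero_add, Nat.descFactorial_self, nsmul_eq_mul]
  split_ifs
  · field_simp
  · simp

lemma eval_lag_comp (β : ℝ) (n : ℕ) : ((lag β n).comp (-Polynomial.X)).eval 0 =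
    gbinom ((n : ℝ) + β) n := by
  simp only [Polynomial.eval_comp, Polynomial.eval_neg, Polynomial.eval_X, neg_zero]
  rw [← Polynomial.coeff_zero_eq_eval_zero, coeff_lag]
  simp

lemma key1 (α : ℝ) (f j : ℕ) : poch (α + 1) j * (iterDeriv j (lag α f)).eval 0 =
    poch (α + 1) f / (f.factorial : ℝ) * (ascPochhammer ℝ j).eval (-(f : ℝ)) := by
  rw [eval_iterDeriv, ← poch_eq_eval, poch_neg]
  split_ifs with h
  · rw [gbinom_eq _ _ _ h]
    have h1 : poch (α + 1) f = poch (α + 1) j * poch (α + j + 1) (f - j) := by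
      conv_lhs => rw [show f = j + (f - j) by omega]
      rw [poch_add]; congr 2; ring
    have h2 : ((f - j).factorial : ℝ) * (f.descFactorial j : ℝ) = f.factorial := by
      exact_mod_cast Nat.factorial_mul_descFactorial h
    rw [h1, ← h2]
    have : (f.descFactorial j : ℝ) ≠ 0 := by
      intro h0; rw [h0] at h2; simp at h2; exact absurd h2.symm (by positivity)
    field_simp
  · rw [Nat.descFactorial_of_lt (by omega)]; simp

lemma key2 (α : ℝ) (g j : ℕ) :
    poch (α + 1) j * ((lag (α + j) g).comp (-Polynomial.X)).eval 0 =
    poch (α + 1) g / (g.factorial : ℝ) * (ascPochhammer ℝ j).eval (α + g + 1) := by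
  rw [eval_lag_comp, ← poch_eq_eval]
  have := gbinom_eq (α + j) g 0 (Nat.zero_le _)
  simp only [Nat.sub_zero, Nat.cast_zero, add_zero] at this
  rw [this]
  have h1 := poch_add (α + 1) j g
  have h2 := poch_add (α + 1) g j
  rw [add_comm g j, h1] at h2
  rw [show α + j + 1 = α + 1 + j by ring, show α + g + 1 = α + 1 + g by ring, ← mul_div_assoc, h2]
  ring

lemma nth_eq (F : Finset ℕ) (a : Fin F.card) : nth F a = F.orderEmbOfFin rfl a := by
  rw [Finset.orderEmbOfFin_apply, nth, List.getD_eq_getElem]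
  · rfl

lemma prod_nth {M : Type*} [CommMonoid M] (F : Finset ℕ) (h : ℕ → M) :
    ∏ f ∈ F, h f = ∏ a : Fin F.card, h (nth F a) := by
  conv_lhs => rw [← Finset.map_orderEmbOfFin_univ F rfl]
  rw [Finset.prod_map]
  exact Finset.prod_congr rfl fun a _ => by rw [nth_eq]; rfl

lemma VF_eq (F : Finset ℕ) : VF F = ∏ a : Fin F.card, ∏ b : Fin F.card,
    if a < b then ((nth F b : ℝ) - nth F a) else 1 := by
  have h1 : VF F = ∏ f ∈ F, ∏ g ∈ F, if f < g then ((g : ℝ) - f) else 1 := by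
    unfold VF
    rw [← Finset.prod_product', Finset.prod_filter, Finset.prod_subset]
    · intro p hp; simp only [Finset.mem_offDiag] at hp; simp [hp.1, hp.2.1]
    · intro p hp hp2
      rw [if_neg]
      intro hlt
      simp only [Finset.mem_product] at hp
      exact hp2 (Finset.mem_offDiag.2 ⟨hp.1, hp.2, hlt.ne⟩)
  rw [h1, prod_nth F]
  refine Finset.prod_congr rfl fun a _ => ?_
  rw [prod_nth F]
  refine Finset.prod_congr rfl fun b _ => ?_
  have : nth F a < nth F b ↔ a < b := by
    rw [nth_eq, nth_eq]; exact (F.orderEmbOfFin rfl).lt_iff_lt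
  simp only [this]

lemma prod_sign (n : ℕ) : (∏ a : Fin n, ∏ b : Fin n, if a < b then (-1 : ℝ) else 1) =
    (-1) ^ (n.choose 2) := by
  induction n with
  | zero => simp
  | succ n ih =>
    rw [Fin.prod_univ_succ]
    simp only [Fin.prod_univ_succ, Fin.succ_lt_succ_iff, Fin.succ_pos, if_true, lt_irrefl,
      if_false, not_lt_of_ge (Fin.zero_le _), one_mul, ih]
    rw [Nat.choose_succ_succ' n 1, pow_add]
    simp

/-- the Vandermonde nodes -/
noncomputable def nodes (α : ℝ) (F1 F2 : Finset ℕ) (i : Fin (F1.card + F2.card)) : ℝ :=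
  if (i : ℕ) < F1.card then -(nth F1 i : ℝ) else α + (nth F2 (i - F1.card) : ℝ) + 1

lemma vand_nodes (α : ℝ) (F1 F2 : Finset ℕ) : (Matrix.vandermonde (nodes α F1 F2)).det =
    (-1 : ℝ) ^ (Nat.choose F1.card 2) * VF F1 * VF F2 *
      ∏ f ∈ F1, ∏ g ∈ F2, (α + (f : ℝ) + (g : ℝ) + 1) := by
  rw [Matrix.det_vandermonde]
  have h1 : ∀ i : Fin (F1.card + F2.card), ∏ j ∈ Finset.Ioi i, (nodes α F1 F2 j - nodes α F1 F2 i)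
      = ∏ j, if i < j then (nodes α F1 F2 j - nodes α F1 F2 i) else 1 := by
    intro i
    rw [← Finset.prod_filter]
    refine Finset.prod_congr ?_ fun _ _ => rfl
    ext; simp
  have n1 : ∀ a : Fin F1.card, nodes α F1 F2 (Fin.castAdd _ a) = -(nth F1 a : ℝ) := by
    intro a; simp [nodes]
  have n2 : ∀ a : Fin F2.card, nodes α F1 F2 (Fin.natAdd _ a) = α + (nth F2 a : ℝ) + 1 := by
    intro a; simp [nodes]
  have l1 : ∀ (a : Fin F1.card) (b : Fin F2.card), Fin.castAdd F2.card a < Fin.natAdd F1.card b := by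
    intro a b; rw [Fin.lt_def]; simp; omega
  have l2 : ∀ (a : Fin F1.card) (b : Fin F2.card), ¬ Fin.natAdd F1.card b < Fin.castAdd F2.card a :=
    fun a b => not_lt_of_gt (l1 a b)
  have l3 : ∀ (a b : Fin F1.card), Fin.castAdd F2.card a < Fin.castAdd F2.card b ↔ a < b :=
    fun a b => Iff.rfl
  have l4 : ∀ (a b : Fin F2.card), Fin.natAdd F1.card a < Fin.natAdd F1.card b ↔ a < b := by
    intro a b; rw [Fin.lt_def, Fin.lt_def]; simp
  simp only [h1, Fin.prod_univ_add, n1, n2, l1, l2, l3, l4, if_true, if_false,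
    Finset.prod_mul_distrib, Finset.prod_const_one, one_mul]
  rw [prod_nth F1, VF_eq F1, VF_eq F2, ← prod_sign]
  have e1 : (∏ a : Fin F1.card, ∏ b : Fin F1.card,
      if a < b then (-(nth F1 b : ℝ) - -(nth F1 a : ℝ)) else 1) =
      (∏ a : Fin F1.card, ∏ b : Fin F1.card, if a < b then (-1 : ℝ) else 1) *
      ∏ a : Fin F1.card, ∏ b : Fin F1.card, if a < b then ((nth F1 b : ℝ) - nth F1 a) else 1 := by
    simp only [← Finset.prod_mul_distrib]
    refine Finset.prod_congr rfl fun a _ => Finset.prod_congr rfl fun b _ => ?_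
    split_ifs <;> ring
  have e2 : (∏ a : Fin F1.card, ∏ b : Fin F2.card, (α + (nth F2 b : ℝ) + 1 - -(nth F1 a : ℝ))) =
      ∏ a : Fin F1.card, ∏ g ∈ F2, (α + (nth F1 a : ℝ) + (g : ℝ) + 1) := by
    refine Finset.prod_congr rfl fun a _ => ?_
    rw [prod_nth F2]
    refine Finset.prod_congr rfl fun b _ => ?_
    ring
  have e3 : (∏ a : Fin F2.card, ∏ b : Fin F2.card,
      if a < b then (α + (nth F2 b : ℝ) + 1 - (α + (nth F2 a : ℝ) + 1)) else 1) =
      ∏ a : Fin F2.card, ∏ b : Fin F2.card, if a < b then ((nth F2 b : ℝ) - nth F2 a) else 1 := by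
    refine Finset.prod_congr rfl fun a _ => Finset.prod_congr rfl fun b _ => ?_
    split_ifs <;> ring
  rw [e1, e2, e3]
  ring

/-- product of the first Pochhammer symbols -/
noncomputable def DD (α : ℝ) (k : ℕ) : ℝ := ∏ j ∈ Finset.range k, poch (α + 1) j

/-- entries of the matrix at zero -/
noncomputable def ent (α : ℝ) (F1 F2 : Finset ℕ) (i j : Fin (F1.card + F2.card)) : ℝ :=
  if (i : ℕ) < F1.card then (iterDeriv (j : ℕ) (lag α (nth F1 (i : ℕ)))).eval 0
    else ((lag (α + ((j : ℕ) : ℝ)) (nth F2 ((i : ℕ) - F1.card))).comp (-Polynomial.X)).eval 0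

lemma eval_Omega (α : ℝ) (F1 F2 : Finset ℕ) :
    (OmegaL α F1 F2).eval 0 = Matrix.det (Matrix.of (ent α F1 F2)) := by
  unfold OmegaL
  rw [← Polynomial.coe_evalRingHom, RingHom.map_det]
  congr 1
  ext i j
  simp only [RingHom.mapMatrix_apply, Matrix.map_apply, Matrix.of_apply, ent]
  split_ifs <;> rfl

lemma DD_mul (α : ℝ) (F1 F2 : Finset ℕ) :
    DD α (F1.card + F2.card) * (OmegaL α F1 F2).eval 0 =
      ((∏ f ∈ F1, poch (α + 1) f / (f.factorial : ℝ)) *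
      (∏ f ∈ F2, poch (α + 1) f / (f.factorial : ℝ))) *
      ((-1 : ℝ) ^ (Nat.choose F1.card 2) * VF F1 * VF F2 *
      ∏ f ∈ F1, ∏ g ∈ F2, (α + (f : ℝ) + (g : ℝ) + 1)) := by
  rw [← vand_nodes, Matrix.det_eval_matrixOfPolynomials_eq_det_vandermonde _
    (fun j : Fin (F1.card + F2.card) => ascPochhammer ℝ j)
    (fun i => ascPochhammer_natDegree ℝ i) (fun i => monic_ascPochhammer ℝ i),
    eval_Omega, DD, Finset.prod_range, ← Matrix.det_mul_row]
  rw [prod_nth F1, prod_nth F2]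
  have : (∏ a : Fin F1.card, poch (α + 1) (nth F1 a) / ((nth F1 a).factorial : ℝ)) *
      (∏ a : Fin F2.card, poch (α + 1) (nth F2 a) / ((nth F2 a).factorial : ℝ)) =
      ∏ i : Fin (F1.card + F2.card), if (i : ℕ) < F1.card then
        poch (α + 1) (nth F1 i) / ((nth F1 i).factorial : ℝ) else
        poch (α + 1) (nth F2 (i - F1.card)) / ((nth F2 (i - F1.card)).factorial : ℝ) := by
    rw [Fin.prod_univ_add]; simp
  rw [this, ← Matrix.det_mul_column]
  congr 1
  ext i j
  simp only [Matrix.of_apply, ent, nodes]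
  split_ifs
  · exact key1 _ _ _
  · exact key2 _ _ _

/-- Pochhammer polynomial `(X + c)_m` -/
noncomputable def pp (c : ℝ) (m : ℕ) : Polynomial ℝ :=
  ∏ i ∈ Finset.range m, (Polynomial.X + Polynomial.C (c + i))

lemma pp_eval (c α : ℝ) (m : ℕ) : (pp c m).eval α = poch (α + c) m := by
  simp [pp, poch, Polynomial.eval_prod, add_assoc]

lemma pp_monic (c : ℝ) (m : ℕ) : (pp c m).Monic :=
  Polynomial.monic_prod_of_monic _ _ fun _ _ => Polynomial.monic_X_add_C _

lemma pp_natDegree (c : ℝ) (m : ℕ) : (pp c m).natDegree = m := by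
  rw [pp, Polynomial.natDegree_prod_of_monic _ _ fun _ _ => Polynomial.monic_X_add_C _]
  simp only [Polynomial.natDegree_X_add_C, Finset.sum_const, Finset.card_range, smul_eq_mul,
    mul_one]

/-- polynomial version of `DD` -/
noncomputable def DDP (k : ℕ) : Polynomial ℝ := ∏ j ∈ Finset.range k, pp 1 j

lemma DDP_eval (α : ℝ) (k : ℕ) : (DDP k).eval α = DD α k := by
  simp [DDP, DD, Polynomial.eval_prod, pp_eval]

lemma DDP_monic (k : ℕ) : (DDP k).Monic :=
  Polynomial.monic_prod_of_monic _ _ fun _ _ => pp_monic _ _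

lemma choose_two_eq_sum (k : ℕ) : ∑ j ∈ Finset.range k, j = k.choose 2 := by
  rw [Finset.sum_range_id, Nat.choose_two_right]

lemma DDP_natDegree (k : ℕ) : (DDP k).natDegree = k.choose 2 := by
  rw [DDP, Polynomial.natDegree_prod_of_monic _ _ fun _ _ => pp_monic _ _]
  simp only [pp_natDegree]
  exact choose_two_eq_sum k

lemma gbinom_poly (c : ℝ) (m : ℕ) : ∃ p : Polynomial ℝ, ∀ α, p.eval α = gbinom (c + α) m := by
  refine ⟨Polynomial.C (1 / (m.factorial : ℝ)) *
    ∏ i ∈ Finset.range m, (Polynomial.X + Polynomial.C (c - i)), fun α => ?_⟩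
  simp only [gbinom, Polynomial.eval_mul, Polynomial.eval_C, Polynomial.eval_prod,
    Polynomial.eval_add, Polynomial.eval_X]
  rw [div_mul_eq_mul_div, one_mul]
  congr 1
  exact Finset.prod_congr rfl fun i _ => by ring

lemma omega_poly (F1 F2 : Finset ℕ) :
    ∃ P : Polynomial ℝ, ∀ α : ℝ, P.eval α = (OmegaL α F1 F2).eval 0 := by
  have h : ∀ i j : Fin (F1.card + F2.card), ∃ p : Polynomial ℝ, ∀ α, p.eval α = ent α F1 F2 i j := by
    intro i j
    unfold ent
    split_ifs
    · simp only [eval_iterDeriv]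
      split_ifs
      · obtain ⟨p, hp⟩ := gbinom_poly (nth F1 i) (nth F1 i - j)
        exact ⟨Polynomial.C ((-1) ^ (j : ℕ)) * p, fun α => by
          rw [Polynomial.eval_mul, Polynomial.eval_C, hp]⟩
      · exact ⟨0, fun α => by simp⟩
    · simp only [eval_lag_comp]
      obtain ⟨p, hp⟩ := gbinom_poly ((nth F2 (i - F1.card) : ℝ) + (j : ℕ)) (nth F2 (i - F1.card))
      exact ⟨p, fun α => by rw [hp]; congr 1; ring⟩
  choose p hp using h
  refine ⟨Matrix.det (Matrix.of p), fun α => ?_⟩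
  rw [eval_Omega, ← Polynomial.coe_evalRingHom, RingHom.map_det]
  congr 1
  ext i j
  simp [hp]

lemma VF_ne_zero (F : Finset ℕ) : VF F ≠ 0 := by
  unfold VF
  rw [Finset.prod_ne_zero_iff]
  intro p hp
  have := (Finset.mem_filter.1 hp).2
  have h2 : (p.1 : ℝ) < p.2 := by exact_mod_cast this
  linarith

/-- the constant in the numerator -/
noncomputable def cst (F1 F2 : Finset ℕ) : ℝ :=
  ((-1 : ℝ) ^ (Nat.choose F1.card 2) * VF F1 * VF F2) /
    ((∏ f ∈ F1, (f.factorial : ℝ)) * (∏ f ∈ F2, (f.factorial : ℝ)))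

lemma fact_ne (F : Finset ℕ) : (∏ f ∈ F, (f.factorial : ℝ)) ≠ 0 :=
  Finset.prod_ne_zero_iff.2 fun f _ => by positivity

lemma cst_ne_zero (F1 F2 : Finset ℕ) : cst F1 F2 ≠ 0 :=
  div_ne_zero (mul_ne_zero (mul_ne_zero (by simp) (VF_ne_zero _)) (VF_ne_zero _))
    (mul_ne_zero (fact_ne _) (fact_ne _))

lemma DD_mul' (α : ℝ) (F1 F2 : Finset ℕ) :
    DD α (F1.card + F2.card) * (OmegaL α F1 F2).eval 0 =
      cst F1 F2 * ((∏ f ∈ F1, poch (α + 1) f) * (∏ f ∈ F2, poch (α + 1) f) *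
      ∏ f ∈ F1, ∏ g ∈ F2, (α + (f : ℝ) + (g : ℝ) + 1)) := by
  rw [DD_mul, Finset.prod_div_distrib, Finset.prod_div_distrib, cst]
  have := fact_ne F1
  have := fact_ne F2
  field_simp

lemma nth_ge (F : Finset ℕ) (hF : ∀ f ∈ F, 0 < f) (a : Fin F.card) : (a : ℕ) + 1 ≤ nth F a := by
  obtain ⟨a, ha⟩ := a
  induction a with
  | zero =>
    have := hF _ (F.orderEmbOfFin_mem rfl ⟨0, ha⟩)
    rw [← nth_eq] at this
    exact Nat.succ_le_of_lt this
  | succ n ih =>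
    have h1 := ih (by omega)
    have h2 : nth F (⟨n, by omega⟩ : Fin F.card) < nth F (⟨n + 1, ha⟩ : Fin F.card) := by
      rw [nth_eq, nth_eq]; exact (F.orderEmbOfFin rfl).strictMono (by simp [Fin.lt_def])
    simp only at h1 h2 ⊢
    omega

lemma sum_ge (F : Finset ℕ) (hF : ∀ f ∈ F, 0 < f) : (F.card + 1).choose 2 ≤ ∑ f ∈ F, f := by
  have h : ∑ f ∈ F, f = ∑ a : Fin F.card, nth F a := by
    conv_lhs => rw [← Finset.map_orderEmbOfFin_univ F rfl]
    rw [Finset.sum_map]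
    exact Finset.sum_congr rfl fun a _ => by rw [nth_eq]; rfl
  rw [h, ← choose_two_eq_sum, Finset.sum_range_succ', add_zero, Finset.sum_range]
  exact Finset.sum_le_sum fun a _ => nth_ge F hF a

lemma choose_two_add (a b : ℕ) : (a + b).choose 2 = a.choose 2 + b.choose 2 + a * b := by
  induction b with
  | zero => simp
  | succ b ih =>
    rw [← add_assoc, Nat.choose_succ_succ' (a + b) 1, Nat.choose_succ_succ' b 1, ih]
    simp; ring

lemma degree_part (F1 F2 : Finset ℕ) (hF1 : ∀ f ∈ F1, 0 < f) (hF2 : ∀ f ∈ F2, 0 < f)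
    (P : Polynomial ℝ) (hP : ∀ α : ℝ, P.eval α = (OmegaL α F1 F2).eval 0) :
    P.degree = ((uF F1 F2 + F1.card : ℕ) : WithBot ℕ) := by
  set N0 : Polynomial ℝ := (∏ f ∈ F1, pp 1 f) * (∏ f ∈ F2, pp 1 f) *
      ∏ f ∈ F1, ∏ g ∈ F2, (Polynomial.X + Polynomial.C ((f : ℝ) + g + 1)) with hN0
  have m1 : ∀ F : Finset ℕ, (∏ f ∈ F, pp 1 f).Monic := fun F =>
    Polynomial.monic_prod_of_monic _ _ fun _ _ => pp_monic _ _
  have m2 : ∀ f : ℕ, (∏ g ∈ F2, (Polynomial.X + Polynomial.C ((f : ℝ) + g + 1))).Monic := fun f =>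
    Polynomial.monic_prod_of_monic _ _ fun _ _ => Polynomial.monic_X_add_C _
  have m3 : (∏ f ∈ F1, ∏ g ∈ F2, (Polynomial.X + Polynomial.C ((f : ℝ) + g + 1))).Monic :=
    Polynomial.monic_prod_of_monic _ _ fun _ _ => m2 _
  have hmon : N0.Monic := ((m1 F1).mul (m1 F2)).mul m3
  have d1 : ∀ F : Finset ℕ, (∏ f ∈ F, pp 1 f).natDegree = ∑ f ∈ F, f := fun F => by
    rw [Polynomial.natDegree_prod_of_monic _ _ fun _ _ => pp_monic _ _]
    simp [pp_natDegree]
  have d3 : (∏ f ∈ F1, ∏ g ∈ F2,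
      (Polynomial.X + Polynomial.C ((f : ℝ) + g + 1))).natDegree = F1.card * F2.card := by
    rw [Polynomial.natDegree_prod_of_monic _ _ fun _ _ => m2 _]
    rw [Finset.sum_congr rfl fun f _ => Polynomial.natDegree_prod_of_monic _ _
      fun _ _ => Polynomial.monic_X_add_C _]
    simp only [Polynomial.natDegree_X_add_C, Finset.sum_const, smul_eq_mul, mul_one]
  have hdeg : N0.natDegree = ∑ f ∈ F1, f + ∑ f ∈ F2, f + F1.card * F2.card := by
    rw [hN0, ((m1 F1).mul (m1 F2)).natDegree_mul m3, (m1 F1).natDegree_mul (m1 F2), d1, d1, d3]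
  have heq : DDP (F1.card + F2.card) * P = Polynomial.C (cst F1 F2) * N0 := by
    refine Polynomial.funext fun α => ?_
    rw [Polynomial.eval_mul, DDP_eval, hP, DD_mul', hN0]
    simp only [Polynomial.eval_mul, Polynomial.eval_C, Polynomial.eval_prod, pp_eval,
      Polynomial.eval_add, Polynomial.eval_X, add_assoc]
  have hne : P ≠ 0 := by
    rintro rfl
    rw [mul_zero] at heq
    exact mul_ne_zero (Polynomial.C_ne_zero.2 (cst_ne_zero F1 F2)) hmon.ne_zero heq.symm
  have h := congrArg Polynomial.natDegree heq
  rw [Polynomial.natDegree_C_mul (cst_ne_zero F1 F2), hdeg,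
    (DDP_monic _).natDegree_mul' hne, DDP_natDegree, choose_two_add] at h
  rw [Polynomial.degree_eq_natDegree hne]
  congr 1
  have s1 := sum_ge F1 hF1
  have s2 := sum_ge F2 hF2
  have c1 := Nat.choose_succ_succ' F1.card 1
  have c2 := Nat.choose_succ_succ' F2.card 1
  simp only [Nat.choose_one_right, Nat.reduceAdd] at c1 c2
  unfold uF
  omega

lemma poch_ne_zero_iff (t : ℝ) (m : ℕ) : poch t m ≠ 0 ↔ ∀ i < m, t + (i : ℝ) ≠ 0 := by
  simp [poch, Finset.prod_ne_zero_iff]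

lemma nonvanish (F1 F2 : Finset ℕ) (α : ℝ) (h : ∀ n : ℕ, α ≠ -((n : ℝ) + 1)) :
    (OmegaL α F1 F2).eval 0 ≠ 0 := by
  have hp : ∀ m, poch (α + 1) m ≠ 0 := fun m => (poch_ne_zero_iff _ _).2 fun i _ h0 =>
    h i (by linarith)
  have := DD_mul' α F1 F2
  intro h0
  rw [h0, mul_zero] at this
  refine mul_ne_zero (cst_ne_zero F1 F2) (mul_ne_zero (mul_ne_zero ?_ ?_) ?_) this.symm
  · exact Finset.prod_ne_zero_iff.2 fun f _ => hp f
  · exact Finset.prod_ne_zero_iff.2 fun f _ => hp f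
  · refine Finset.prod_ne_zero_iff.2 fun f _ => Finset.prod_ne_zero_iff.2 fun g _ h1 => ?_
    exact h (f + g) (by push_cast; linarith)

lemma poch_shift (α : ℝ) (i n : ℕ) (hi : 1 ≤ i) :
    poch (α + 1) (i - 1) * poch (α + i) n = poch (α + 1) (i - 1 + n) := by
  rw [poch_add]; congr 2
  push_cast [Nat.cast_sub hi]; ring

lemma prod_Icc_range (k : ℕ) (h : ℕ → ℝ) :
    ∏ i ∈ Finset.Icc 1 k, h i = ∏ j ∈ Finset.range k, h (j + 1) := by
  rw [Finset.range_eq_Ico, Finset.prod_Ico_add' h 0 k 1]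
  rfl

lemma L1 (α : ℝ) (k : ℕ) : DD α k * ∏ i ∈ Finset.Icc 1 k, poch (α + (i : ℝ)) (k - i + 1) =
    poch (α + 1) k ^ k := by
  rw [prod_Icc_range k (fun i => poch (α + (i : ℝ)) (k - i + 1)), DD, ← Finset.prod_mul_distrib]
  rw [Finset.prod_congr rfl (g := fun _ => poch (α + 1) k)]
  · simp
  · intro j hj
    have hj := Finset.mem_range.1 hj
    have := poch_shift α (j + 1) (k - (j + 1) + 1) (by omega)
    rw [Nat.add_sub_cancel] at this
    rw [this]; congr 1; omega

lemma L2 (α : ℝ) (k f : ℕ) (h : poch (α + 1) k ≠ 0) :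
    poch (α + 1) k * pochZ (α + (k : ℝ) + 1) ((f : ℤ) - (k : ℤ)) = poch (α + 1) f := by
  unfold pochZ
  split_ifs with h0
  · have e : ((f : ℤ) - (k : ℤ)).toNat = f - k := by omega
    have : f = k + (f - k) := by omega
    rw [e]
    conv_rhs => rw [this, poch_add, show α + 1 + (k : ℝ) = α + k + 1 by ring]
    rfl
  · have e : (-((f : ℤ) - (k : ℤ))).toNat = k - f := by omega
    have hk : k = f + (k - f) := by omega
    have e2 : ∏ i ∈ Finset.range (k - f), (α + (k : ℝ) + 1 - ((i : ℝ) + 1)) =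
        poch (α + 1 + f) (k - f) := by
      rw [poch, ← Finset.prod_range_reflect]
      refine Finset.prod_congr rfl fun i hi => ?_
      have hi := Finset.mem_range.1 hi
      have : k - f - 1 - i + (1 + i + f) = k := by omega
      have h2 : ((k - f - 1 - i : ℕ) : ℝ) = k - (1 + i + f) := by
        rw [eq_sub_iff_add_eq]; exact_mod_cast this
      rw [h2]; ring
    rw [e, e2]
    have h3 : poch (α + 1) k = poch (α + 1) f * poch (α + 1 + f) (k - f) := by
      conv_lhs => rw [hk]
      rw [poch_add]
    rw [h3] at h ⊢
    have := right_ne_zero_of_mul h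
    field_simp

lemma L12 (α : ℝ) (F : Finset ℕ) (h : poch (α + 1) F.card ≠ 0) :
    DD α F.card * ((∏ i ∈ Finset.Icc 1 F.card, poch (α + (i : ℝ)) (F.card - i + 1)) *
      ∏ f ∈ F, pochZ (α + (F.card : ℝ) + 1) ((f : ℤ) - (F.card : ℤ))) =
      ∏ f ∈ F, poch (α + 1) f := by
  rw [← mul_assoc, L1]
  rw [← Finset.prod_const (s := F), ← Finset.prod_mul_distrib]
  exact Finset.prod_congr rfl fun f _ => L2 α _ f h

lemma L3' (α : ℝ) (m n : ℕ) (hmn : m ≤ n) :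
    DD α m * DD α n * (∏ i ∈ Finset.Icc 1 m, poch (α + (i : ℝ)) (n + m - 2 * i + 1)) =
      DD α (n + m) := by
  have : DD α m * (∏ i ∈ Finset.Icc 1 m, poch (α + (i : ℝ)) (n + m - 2 * i + 1)) =
      ∏ j ∈ Finset.range m, poch (α + 1) (n + j) := by
    rw [← Finset.prod_range_reflect,
      prod_Icc_range m (fun i => poch (α + (i : ℝ)) (n + m - 2 * i + 1)), DD,
      ← Finset.prod_mul_distrib]
    refine Finset.prod_congr rfl fun j hj => ?_
    have hj := Finset.mem_range.1 hj
    have := poch_shift α (j + 1) (n + m - 2 * (j + 1) + 1) (by omega)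
    rw [Nat.add_sub_cancel] at this
    rw [this]; congr 1; omega
  rw [mul_right_comm, this, DD, DD, Finset.prod_range_add, mul_comm]

lemma L3 (α : ℝ) (k1 k2 : ℕ) :
    DD α k1 * DD α k2 * (∏ i ∈ Finset.Icc 1 (min k1 k2), poch (α + (i : ℝ)) (k1 + k2 - 2 * i + 1)) =
      DD α (k1 + k2) := by
  rcases le_total k1 k2 with h | h
  · rw [min_eq_left h, add_comm k1 k2]; exact L3' α k1 k2 h
  · rw [min_eq_right h, mul_comm (DD α k1)]; exact L3' α k2 k1 h

lemma poch_ne_of_le {t : ℝ} {m n : ℕ} (h : m ≤ n) (hn : poch t n ≠ 0) : poch t m ≠ 0 := by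
  rw [poch_ne_zero_iff] at hn ⊢
  exact fun i hi => hn i (by omega)

/-- one of the two sets is empty and `α ∈ {-1, …, -k}` -/
lemma vanish (F1 F2 F : Finset ℕ) (hF : ∀ f ∈ F, 0 < f) (hc : F1.card + F2.card = F.card)
    (hN : ∀ α : ℝ, (∏ f ∈ F1, poch (α + 1) f) * (∏ f ∈ F2, poch (α + 1) f) *
      ∏ f ∈ F1, ∏ g ∈ F2, (α + (f : ℝ) + (g : ℝ) + 1) = ∏ f ∈ F, poch (α + 1) f)
    (α : ℝ) (h : poch (α + 1) F.card = 0) : (OmegaL α F1 F2).eval 0 = 0 := by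
  obtain ⟨P, hP⟩ := omega_poly F1 F2
  have heq : DDP F.card * P = DDP F.card * (Polynomial.C (cst F1 F2) *
      ∏ a : Fin F.card, pp ((a : ℕ) + 1) (nth F a - a)) := by
    refine Polynomial.funext fun α => ?_
    rw [Polynomial.eval_mul, Polynomial.eval_mul, DDP_eval, hP, ← hc, DD_mul', hN, hc]
    simp only [Polynomial.eval_mul, Polynomial.eval_C, Polynomial.eval_prod, pp_eval]
    rw [mul_left_comm, DD, Finset.prod_range, ← Finset.prod_mul_distrib, prod_nth]
    congr 1
    refine Finset.prod_congr rfl fun a _ => ?_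
    have h1 : nth F a = a + (nth F a - a) := by have := nth_ge F hF a; omega
    conv_lhs => rw [h1, poch_add]
    congr 2; ring
  have h2 := mul_left_cancel₀ (DDP_monic _).ne_zero heq
  rw [← hP, h2]
  simp only [Polynomial.eval_mul, Polynomial.eval_C, Polynomial.eval_prod, pp_eval]
  obtain ⟨i, hi, h0⟩ := Finset.prod_eq_zero_iff.1 h
  refine mul_eq_zero_of_right _ (Finset.prod_eq_zero (Finset.mem_univ ⟨i, Finset.mem_range.1 hi⟩) ?_)
  have h1 := nth_ge F hF ⟨i, Finset.mem_range.1 hi⟩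
  refine Finset.prod_eq_zero (i := 0) (Finset.mem_range.2 ?_) ?_
  · simp only at h1 ⊢; omega
  · simp only [Nat.cast_zero]; linarith

lemma icc_zero (α : ℝ) (k : ℕ) (h : poch (α + 1) k = 0) :
    ∏ i ∈ Finset.Icc 1 k, poch (α + (i : ℝ)) (k - i + 1) = 0 := by
  have hk : 1 ≤ k := by
    rcases Nat.eq_zero_or_pos k with rfl | h'
    · simp [poch] at h
    · exact h'
  refine Finset.prod_eq_zero (i := 1) (Finset.mem_Icc.2 ⟨le_rfl, hk⟩) ?_
  rw [Nat.sub_add_cancel hk]; simpa using h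

lemma alg_aux (D1 D2 M Ω s V1 V2 C1 C2 A1 B1 A2 B2 Q : ℝ)
    (hD : D1 * D2 * M ≠ 0) (f1 : C1 ≠ 0) (f2 : C2 ≠ 0)
    (hm : D1 * D2 * M * Ω = s * V1 * V2 / (C1 * C2) * (D1 * (A1 * B1) * (D2 * (A2 * B2)) * Q)) :
    Ω = s * ((V1 * A1 * B1) * (V2 * A2 * B2)) / (C1 * C2 * M) * Q := by
  have hM : M ≠ 0 := right_ne_zero_of_mul hD
  refine mul_left_cancel₀ hD ?_
  rw [hm]
  field_simp

lemma formula_main (F1 F2 : Finset ℕ) (α : ℝ)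
    (hD : DD α (F1.card + F2.card) ≠ 0) (h1 : poch (α + 1) F1.card ≠ 0)
    (h2 : poch (α + 1) F2.card ≠ 0) :
    (OmegaL α F1 F2).eval 0 =
        (-1 : ℝ) ^ (Nat.choose F1.card 2) *
          ((VF F1 * (∏ i ∈ Finset.Icc 1 F1.card, poch (α + (i : ℝ)) (F1.card - i + 1)) *
              ∏ f ∈ F1, pochZ (α + (F1.card : ℝ) + 1) ((f : ℤ) - (F1.card : ℤ))) *
            (VF F2 * (∏ i ∈ Finset.Icc 1 F2.card, poch (α + (i : ℝ)) (F2.card - i + 1)) *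
              ∏ f ∈ F2, pochZ (α + (F2.card : ℝ) + 1) ((f : ℤ) - (F2.card : ℤ)))) /
          ((∏ f ∈ F1, (Nat.factorial f : ℝ)) * (∏ f ∈ F2, (Nat.factorial f : ℝ)) *
            ∏ i ∈ Finset.Icc 1 (min F1.card F2.card),
              poch (α + (i : ℝ)) (F1.card + F2.card - 2 * i + 1)) *
          ∏ f ∈ F1, ∏ g ∈ F2, (α + (f : ℝ) + (g : ℝ) + 1) := by
  have hm := DD_mul' α F1 F2
  rw [← L12 α F1 h1, ← L12 α F2 h2, ← L3, cst] at hm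
  rw [← L3] at hD
  have f1 := fact_ne F1
  have f2 := fact_ne F2
  exact alg_aux _ _ _ _ _ _ _ _ _ _ _ _ _ _ hD f1 f2 hm

lemma formula (F1 F2 : Finset ℕ) (hF1 : ∀ f ∈ F1, 0 < f) (hF2 : ∀ f ∈ F2, 0 < f) (α : ℝ)
    (hM : (∏ i ∈ Finset.Icc 1 (min F1.card F2.card),
        poch (α + (i : ℝ)) (F1.card + F2.card - 2 * i + 1)) ≠ 0) :
    (OmegaL α F1 F2).eval 0 =
        (-1 : ℝ) ^ (Nat.choose F1.card 2) *
          ((VF F1 * (∏ i ∈ Finset.Icc 1 F1.card, poch (α + (i : ℝ)) (F1.card - i + 1)) *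
              ∏ f ∈ F1, pochZ (α + (F1.card : ℝ) + 1) ((f : ℤ) - (F1.card : ℤ))) *
            (VF F2 * (∏ i ∈ Finset.Icc 1 F2.card, poch (α + (i : ℝ)) (F2.card - i + 1)) *
              ∏ f ∈ F2, pochZ (α + (F2.card : ℝ) + 1) ((f : ℤ) - (F2.card : ℤ)))) /
          ((∏ f ∈ F1, (Nat.factorial f : ℝ)) * (∏ f ∈ F2, (Nat.factorial f : ℝ)) *
            ∏ i ∈ Finset.Icc 1 (min F1.card F2.card),
              poch (α + (i : ℝ)) (F1.card + F2.card - 2 * i + 1)) *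
          ∏ f ∈ F1, ∏ g ∈ F2, (α + (f : ℝ) + (g : ℝ) + 1) := by
  have hDD : poch (α + 1) (F1.card + F2.card - 1) ≠ 0 → DD α (F1.card + F2.card) ≠ 0 := fun h =>
    Finset.prod_ne_zero_iff.2 fun j hj => poch_ne_of_le (by have := Finset.mem_range.1 hj; omega) h
  by_cases hk : poch (α + 1) (F1.card + F2.card) = 0
  · rcases Nat.eq_zero_or_pos F1.card with h1 | h1
    · have e1 : F1 = ∅ := Finset.card_eq_zero.1 h1
      rw [h1, zero_add] at hk
      rw [vanish F1 F2 F2 hF2 (by omega) (by intro α; simp [e1]) α hk, icc_zero α F2.card hk]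
      simp
    rcases Nat.eq_zero_or_pos F2.card with h2 | h2
    · have e2 : F2 = ∅ := Finset.card_eq_zero.1 h2
      rw [h2, add_zero] at hk
      rw [vanish F1 F2 F1 hF1 (by omega) (by intro α; simp [e2]) α hk, icc_zero α F1.card hk]
      simp
    have hp := Finset.prod_ne_zero_iff.1 hM 1 (Finset.mem_Icc.2 ⟨le_rfl, by omega⟩)
    rw [show F1.card + F2.card - 2 * 1 + 1 = F1.card + F2.card - 1 by omega, Nat.cast_one] at hp
    exact formula_main F1 F2 α (hDD hp) (poch_ne_of_le (by omega) hp) (poch_ne_of_le (by omega) hp)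
  · exact formula_main F1 F2 α (hDD (poch_ne_of_le (by omega) hk)) (poch_ne_of_le (by omega) hk)
      (poch_ne_of_le (by omega) hk)

/-- Lemma 5.2: (i) `α ↦ Ω_𝓕^α(0)` is a polynomial in `α` of degree `u_𝓕 + k₁` which does not
vanish at any `α ∉ {-1, -2, -3, …}`; (ii) the explicit product formula for `Ω_𝓕^α(0)`. -/
theorem omegaL_at_zero (F1 F2 : Finset ℕ) (hF1 : ∀ f ∈ F1, 0 < f) (hF2 : ∀ f ∈ F2, 0 < f)
    (hne : F1.Nonempty ∨ F2.Nonempty) :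
    (∃ P : Polynomial ℝ, P.degree = ((uF F1 F2 + F1.card : ℕ) : WithBot ℕ) ∧
      (∀ α : ℝ, P.eval α = (OmegaL α F1 F2).eval 0) ∧
      (∀ α : ℝ, (∀ n : ℕ, α ≠ -((n : ℝ) + 1)) → P.eval α ≠ 0)) ∧
    (∀ α : ℝ,
      (∏ i ∈ Finset.Icc 1 (min F1.card F2.card),
        poch (α + (i : ℝ)) (F1.card + F2.card - 2 * i + 1)) ≠ 0 →
      (OmegaL α F1 F2).eval 0 =
        (-1 : ℝ) ^ (Nat.choose F1.card 2) *
          ((VF F1 * (∏ i ∈ Finset.Icc 1 F1.card, poch (α + (i : ℝ)) (F1.card - i + 1)) *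
              ∏ f ∈ F1, pochZ (α + (F1.card : ℝ) + 1) ((f : ℤ) - (F1.card : ℤ))) *
            (VF F2 * (∏ i ∈ Finset.Icc 1 F2.card, poch (α + (i : ℝ)) (F2.card - i + 1)) *
              ∏ f ∈ F2, pochZ (α + (F2.card : ℝ) + 1) ((f : ℤ) - (F2.card : ℤ)))) /
          ((∏ f ∈ F1, (Nat.factorial f : ℝ)) * (∏ f ∈ F2, (Nat.factorial f : ℝ)) *
            ∏ i ∈ Finset.Icc 1 (min F1.card F2.card),
              poch (α + (i : ℝ)) (F1.card + F2.card - 2 * i + 1)) *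
          ∏ f ∈ F1, ∏ g ∈ F2, (α + (f : ℝ) + (g : ℝ) + 1)) := by
  obtain ⟨P, hP⟩ := omega_poly F1 F2
  exact ⟨⟨P, degree_part F1 F2 hF1 hF2 P hP, hP, fun α h => by
    rw [hP]; exact nonvanish F1 F2 α h⟩, fun α hM => formula F1 F2 hF1 hF2 α hM⟩
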